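/- Rains' trace formula: the number of fixed point free involutions of {1,...,2N} with longest decreasing subsequence at most 2p equals the expectation ⟨(Tr S)^{2N}⟩ over S drawn from the Haar measure on the unitary symplectic group USp(2p) (2p × 2p unitary symplectic matrices). -/

import Mathlib

open MeasureTheory

/-- The unitary symplectic group `USp(2p) = Sp(2p,ℂ) ∩ U(2p)`, as a subgroup of the
unitary group of `2p × 2p` complex matrices (indexed by `Fin p ⊕ Fin p`). -/
def USp (p : ℕ) : Subgroup (Matrix.unitaryGroup (Fin p ⊕ Fin p) ℂ) where
  carrier := {S | (S : Matrix (Fin p ⊕ Fin p) (Fin p ⊕ Fin p) ℂ) ∈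
    Matrix.symplecticGroup (Fin p) ℂ}
  mul_mem' := by
    intro a b ha hb
    exact (Matrix.symplecticGroup (Fin p) ℂ).mul_mem ha hb
  one_mem' := (Matrix.symplecticGroup (Fin p) ℂ).one_mem
  inv_mem' := by
    intro a ha
    show star (a : Matrix (Fin p ⊕ Fin p) (Fin p ⊕ Fin p) ℂ) ∈
      Matrix.symplecticGroup (Fin p) ℂ
    have h1 : star (a : Matrix (Fin p ⊕ Fin p) (Fin p ⊕ Fin p) ℂ) =
        (a : Matrix (Fin p ⊕ Fin p) (Fin p ⊕ Fin p) ℂ)⁻¹ :=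
      (Matrix.inv_eq_left_inv (Matrix.UnitaryGroup.star_mul_self a)).symm
    rw [h1, SymplecticGroup.inv_eq_symplectic_inv _ ha]
    exact Submonoid.mul_mem _
      (Submonoid.mul_mem _
        (SymplecticGroup.neg_mem (SymplecticGroup.J_mem _ _))
        (SymplecticGroup.transpose_mem ha))
      (SymplecticGroup.J_mem _ _)

/-- `σ` has a decreasing subsequence of length `q`. -/
def HasDecSub {M : ℕ} (σ : Equiv.Perm (Fin M)) (q : ℕ) : Prop :=
  ∃ t : Fin q → Fin M, StrictMono t ∧ StrictAnti (fun a => σ (t a))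

namespace RainsTrace

set_option linter.unusedSectionVars false

open Equiv Function Finset

section Tensors

variable {α : Type*} [Fintype α] [LinearOrder α] {p : ℕ}

/-- The tensor attached to the arcs `i < σ i` of an involution `σ`: the product over all arcs of
the symplectic form evaluated at the two endpoints. -/
def matchTensor (σ : Perm α) (w : α → Fin p ⊕ Fin p) : ℂ :=
  ∏ i with i < σ i, Matrix.J (Fin p) ℂ (w i) (w (σ i))

/-- The action of a matrix `X`, as an element of the Lie algebra `𝔤𝔩`, on the tensor slots in
`A`. -/
def lieAct (A : Finset α) (X : Matrix (Fin p ⊕ Fin p) (Fin p ⊕ Fin p) ℂ)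
    (v : (α → Fin p ⊕ Fin p) → ℂ) (w : α → Fin p ⊕ Fin p) : ℂ :=
  ∑ i ∈ A, ∑ c, X (w i) c * v (update w i c)

/-- The contraction of the slots `i` and `j` against the symplectic form. -/
def contract (i j : α) (v : (α → Fin p ⊕ Fin p) → ℂ) (w : α → Fin p ⊕ Fin p) : ℂ :=
  ∑ a, ∑ c, Matrix.J (Fin p) ℂ a c * v (update (update w i a) j c)

theorem J_antisymm (a c : Fin p ⊕ Fin p) :
    Matrix.J (Fin p) ℂ a c = -Matrix.J (Fin p) ℂ c a := by
  have h := congrFun (congrFun (Matrix.J_transpose (Fin p) ℂ) c) a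
  simpa [Matrix.transpose_apply] using h

theorem star_J (a c : Fin p ⊕ Fin p) :
    star (Matrix.J (Fin p) ℂ a c) = Matrix.J (Fin p) ℂ a c := by
  rcases a with a | a <;> rcases c with c | c <;>
    simp [Matrix.J, Matrix.one_apply, apply_ite (starRingEnd ℂ)]

theorem J_ne_zero_iff (a c : Fin p ⊕ Fin p) : Matrix.J (Fin p) ℂ a c ≠ 0 ↔ c = a.swap := by
  rcases a with a | a <;> rcases c with c | c <;>
    simp [Matrix.J, Matrix.one_apply, eq_comm]

theorem sum_J_mul_J (b c : Fin p ⊕ Fin p) :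
    ∑ a, Matrix.J (Fin p) ℂ a b * Matrix.J (Fin p) ℂ a c = if b = c then 1 else 0 := by
  have h : (Matrix.J (Fin p) ℂ).transpose * Matrix.J (Fin p) ℂ = 1 := by
    rw [Matrix.J_transpose, neg_mul, Matrix.J_squared, neg_neg]
  have := congrFun (congrFun h b) c
  simpa only [Matrix.mul_apply, Matrix.one_apply, Matrix.transpose_apply] using this

theorem sum_update_comm {κ : Type*} [Fintype κ] {R : Type*} [AddCommMonoid R]
    (i : α) (F : (α → κ) → κ → R) :
    ∑ w, ∑ c, F w c = ∑ w, ∑ c, F (update w i c) (w i) := by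
  rw [← Fintype.sum_prod_type', ← Fintype.sum_prod_type']
  refine Finset.sum_nbij' (fun x => (update x.1 i x.2, x.1 i))
    (fun x => (update x.1 i x.2, x.1 i)) ?_ ?_ ?_ ?_ ?_ <;> simp

theorem sum_sum_update {κ : Type*} [Fintype κ] (i : α) (f : (α → κ) → ℂ) :
    ∑ w, ∑ c, f (update w i c) = Fintype.card κ * ∑ w, f w := by
  rw [sum_update_comm i (fun w c => f (update w i c))]
  simp [Finset.mul_sum]

/-- `E_{ab}` and `E_{ba}` are mutually adjoint. -/
theorem sum_star_lieAct_single (A : Finset α) (a b : Fin p ⊕ Fin p)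
    (u v : (α → Fin p ⊕ Fin p) → ℂ) :
    ∑ w, star (lieAct A (Matrix.single a b 1) u w) * v w =
      ∑ w, star (u w) * lieAct A (Matrix.single b a 1) v w := by
  simp only [lieAct, star_sum, Finset.sum_mul, Finset.mul_sum]
  rw [Finset.sum_comm, Finset.sum_comm (s := univ) (t := A)]
  refine Finset.sum_congr rfl fun i _ => ?_
  rw [sum_update_comm i]
  refine Finset.sum_congr rfl fun w _ => Finset.sum_congr rfl fun c _ => ?_
  by_cases h : a = c <;> by_cases h' : b = w i <;> simp [h, h']

theorem lieAct_add (A : Finset α) (X Y : Matrix (Fin p ⊕ Fin p) (Fin p ⊕ Fin p) ℂ)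
    (v : (α → Fin p ⊕ Fin p) → ℂ) : lieAct A (X + Y) v = lieAct A X v + lieAct A Y v := by
  ext w
  simp [lieAct, add_mul, Finset.sum_add_distrib]

theorem lieAct_smul (A : Finset α) (z : ℂ) (X : Matrix (Fin p ⊕ Fin p) (Fin p ⊕ Fin p) ℂ)
    (v : (α → Fin p ⊕ Fin p) → ℂ) : lieAct A (z • X) v = z • lieAct A X v := by
  ext w
  simp only [lieAct, Matrix.smul_apply, smul_eq_mul, Pi.smul_apply, Finset.mul_sum, mul_assoc]

theorem lieAct_neg_arg (A : Finset α) (X : Matrix (Fin p ⊕ Fin p) (Fin p ⊕ Fin p) ℂ)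
    (v : (α → Fin p ⊕ Fin p) → ℂ) : lieAct A X (-v) = -lieAct A X v := by
  ext w
  simp only [lieAct, Pi.neg_apply, mul_neg, Finset.sum_neg_distrib]

theorem symplectic_part_mem (Y : Matrix (Fin p ⊕ Fin p) (Fin p ⊕ Fin p) ℂ) :
    (Y + Matrix.J (Fin p) ℂ * Y.transpose * Matrix.J (Fin p) ℂ).transpose * Matrix.J (Fin p) ℂ +
      Matrix.J (Fin p) ℂ * (Y + Matrix.J (Fin p) ℂ * Y.transpose * Matrix.J (Fin p) ℂ) = 0 := by
  have h := Matrix.J_squared (Fin p) ℂ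
  simp only [Matrix.transpose_add, Matrix.transpose_mul, Matrix.J_transpose,
    Matrix.transpose_transpose, Matrix.add_mul, Matrix.mul_add, Matrix.neg_mul, Matrix.mul_neg,
    neg_neg]
  have h1 : Matrix.J (Fin p) ℂ * (Y * Matrix.J (Fin p) ℂ) * Matrix.J (Fin p) ℂ =
      -(Matrix.J (Fin p) ℂ * Y) := by
    rw [Matrix.mul_assoc, Matrix.mul_assoc, h]; simp
  have h2 : Matrix.J (Fin p) ℂ * (Matrix.J (Fin p) ℂ * Y.transpose * Matrix.J (Fin p) ℂ) =
      -(Y.transpose * Matrix.J (Fin p) ℂ) := by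
    rw [← Matrix.mul_assoc, ← Matrix.mul_assoc, h]; simp
  rw [h1, h2]
  abel

theorem lieAct_single_eq_neg {A : Finset α} {v : (α → Fin p ⊕ Fin p) → ℂ}
    (hinv : ∀ X : Matrix (Fin p ⊕ Fin p) (Fin p ⊕ Fin p) ℂ,
      X.transpose * Matrix.J (Fin p) ℂ + Matrix.J (Fin p) ℂ * X = 0 → lieAct A X v = 0)
    (a b : Fin p ⊕ Fin p) :
    lieAct A (Matrix.single a b 1) v =
      -lieAct A (Matrix.J (Fin p) ℂ * Matrix.single b a 1 * Matrix.J (Fin p) ℂ) v := by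
  have h := hinv _ (symplectic_part_mem (Matrix.single a b 1))
  rw [lieAct_add, Matrix.transpose_single] at h
  exact eq_neg_of_add_eq_zero_left h

theorem sum_lieAct_lieAct {A : Finset α} {v : (α → Fin p ⊕ Fin p) → ℂ}
    (htr : ∀ i ∈ A, ∀ j ∈ A, i ≠ j → contract i j v = 0) (w : α → Fin p ⊕ Fin p) :
    ∑ a, ∑ b, lieAct A (Matrix.single b a 1)
      (lieAct A (Matrix.J (Fin p) ℂ * Matrix.single b a 1 * Matrix.J (Fin p) ℂ) v) w =
      A.card * v w := by
  have hJ : ∀ a b x y : Fin p ⊕ Fin p,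
      (Matrix.J (Fin p) ℂ * (Matrix.single b a 1 : Matrix _ _ ℂ) * Matrix.J (Fin p) ℂ) x y =
        Matrix.J (Fin p) ℂ x b * Matrix.J (Fin p) ℂ a y := by
    intro a b x y
    simp [Matrix.mul_apply, Matrix.single_apply, ite_and, -Fintype.sum_sum_type]
  have hstep : ∀ a, ∑ b, lieAct A (Matrix.single b a 1)
      (lieAct A (Matrix.J (Fin p) ℂ * Matrix.single b a 1 * Matrix.J (Fin p) ℂ) v) w =
      ∑ i ∈ A, ∑ j ∈ A, ∑ c, Matrix.J (Fin p) ℂ (update w i a j) (w i) *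
        Matrix.J (Fin p) ℂ a c * v (update (update w i a) j c) := by
    intro a
    simp only [lieAct, hJ]
    rw [Finset.sum_comm]
    refine Finset.sum_congr rfl fun i _ => ?_
    simp [Matrix.single_apply, ite_and, -Fintype.sum_sum_type]
  simp only [hstep]
  rw [Finset.sum_comm]
  have hi : ∀ i ∈ A, ∑ a, ∑ j ∈ A, ∑ c, Matrix.J (Fin p) ℂ (update w i a j) (w i) *
        Matrix.J (Fin p) ℂ a c * v (update (update w i a) j c) = v w := by
    intro i hi
    rw [Finset.sum_comm, Finset.sum_eq_single_of_mem i hi]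
    · simp only [update_self, update_idem]
      rw [Finset.sum_comm]
      simp only [← Finset.sum_mul, sum_J_mul_J]
      simp
    · intro j hj hji
      have h := congrFun (htr i hi j hj hji.symm) w
      simp only [contract, Pi.zero_apply] at h
      simp only [update_of_ne hji, mul_assoc, ← Finset.mul_sum, h, mul_zero]
  rw [Finset.sum_congr rfl hi]
  simp

/-- A nonempty family of slots carries no invariant all of whose contractions vanish. -/
theorem eq_zero_of_contract_eq_zero {A : Finset α} (hA : A.Nonempty)
    {v : (α → Fin p ⊕ Fin p) → ℂ}
    (hinv : ∀ X : Matrix (Fin p ⊕ Fin p) (Fin p ⊕ Fin p) ℂ,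
      X.transpose * Matrix.J (Fin p) ℂ + Matrix.J (Fin p) ℂ * X = 0 → lieAct A X v = 0)
    (htr : ∀ i ∈ A, ∀ j ∈ A, i ≠ j → contract i j v = 0) : v = 0 := by
  have key : ∑ a, ∑ b, ∑ w, star (lieAct A (Matrix.single a b 1) v w) *
      lieAct A (Matrix.single a b 1) v w = -(A.card * ∑ w, star (v w) * v w) := by
    have h1 : ∀ a b, ∑ w, star (lieAct A (Matrix.single a b 1) v w) *
        lieAct A (Matrix.single a b 1) v w = ∑ w, -(star (v w) * lieAct A (Matrix.single b a 1)
          (lieAct A (Matrix.J (Fin p) ℂ * Matrix.single b a 1 * Matrix.J (Fin p) ℂ) v) w) := by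
      intro a b
      rw [sum_star_lieAct_single]
      refine Finset.sum_congr rfl fun w _ => ?_
      rw [lieAct_single_eq_neg hinv a b, lieAct_neg_arg, Pi.neg_apply, mul_neg]
    simp only [h1]
    have h2 : ∀ w, ∑ a, ∑ b, -(star (v w) * lieAct A (Matrix.single b a 1)
          (lieAct A (Matrix.J (Fin p) ℂ * Matrix.single b a 1 * Matrix.J (Fin p) ℂ) v) w) =
        -(star (v w) * (A.card * v w)) := by
      intro w
      rw [← sum_lieAct_lieAct htr w]
      simp only [Finset.mul_sum, Finset.sum_neg_distrib]
    rw [Finset.sum_congr rfl fun a _ => Finset.sum_comm, Finset.sum_comm]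
    rw [Finset.sum_congr rfl fun w _ => h2 w, Finset.sum_neg_distrib, Finset.mul_sum]
    congr 1
    exact Finset.sum_congr rfl fun w _ => by ring
  have hsq : ∀ z : ℂ, star z * z = ((Complex.normSq z : ℝ) : ℂ) := fun z => by
    rw [← Complex.mul_conj, mul_comm]; rfl
  simp only [hsq] at key
  have key' : ∑ a, ∑ b, ∑ w, Complex.normSq (lieAct A (Matrix.single a b 1) v w) =
      -(A.card * ∑ w, Complex.normSq (v w)) := by exact_mod_cast key
  have hpos : 0 ≤ ∑ a, ∑ b, ∑ w, Complex.normSq (lieAct A (Matrix.single a b 1) v w) :=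
    Finset.sum_nonneg fun a _ => Finset.sum_nonneg fun b _ => Finset.sum_nonneg fun w _ =>
      Complex.normSq_nonneg _
  have hcard : (0 : ℝ) < A.card := by exact_mod_cast hA.card_pos
  have hnn : 0 ≤ ∑ w, Complex.normSq (v w) :=
    Finset.sum_nonneg fun w _ => Complex.normSq_nonneg _
  have hz : ∑ w, Complex.normSq (v w) = 0 := by nlinarith
  ext w
  exact Complex.normSq_eq_zero.1
    ((Finset.sum_eq_zero_iff_of_nonneg fun w _ => Complex.normSq_nonneg _).1 hz w (mem_univ w))

/-- Contractions commute with the action of the symplectic Lie algebra. -/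
theorem lieAct_contract {A : Finset α} {i j : α} (hi : i ∈ A) (hj : j ∈ A) (hij : i ≠ j)
    (v : (α → Fin p ⊕ Fin p) → ℂ) {X : Matrix (Fin p ⊕ Fin p) (Fin p ⊕ Fin p) ℂ}
    (hX : X.transpose * Matrix.J (Fin p) ℂ + Matrix.J (Fin p) ℂ * X = 0) :
    lieAct ((A.erase i).erase j) X (contract i j v) = contract i j (lieAct A X v) := by
  ext w
  have hsplit : ∀ w', lieAct A X v w' = (∑ k ∈ (A.erase i).erase j,
      ∑ d, X (w' k) d * v (update w' k d)) + (∑ d, X (w' j) d * v (update w' j d)) +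
      ∑ d, X (w' i) d * v (update w' i d) := by
    intro w'
    rw [lieAct, ← Finset.sum_erase_add _ _ hi,
      ← Finset.sum_erase_add _ _ (Finset.mem_erase.2 ⟨hij.symm, hj⟩)]
  simp only [contract, hsplit, mul_add, Finset.sum_add_distrib]
  have h1 : ∑ a, ∑ c, Matrix.J (Fin p) ℂ a c *
      ∑ d, X (update (update w i a) j c i) d * v (update (update (update w i a) j c) i d) =
      ∑ a, ∑ c, (X.transpose * Matrix.J (Fin p) ℂ) a c * v (update (update w i a) j c) := by
    simp only [Matrix.mul_apply, Matrix.transpose_apply, Finset.sum_mul, Finset.mul_sum]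
    rw [Finset.sum_congr rfl fun a _ => Finset.sum_comm, Finset.sum_comm,
      Finset.sum_congr rfl fun a _ => Finset.sum_comm]
    refine Finset.sum_congr rfl fun d _ => Finset.sum_congr rfl fun c _ =>
      Finset.sum_congr rfl fun a _ => ?_
    rw [update_of_ne hij, update_self, update_comm hij.symm, update_idem]
    ring
  have h2 : ∑ a, ∑ c, Matrix.J (Fin p) ℂ a c *
      ∑ d, X (update (update w i a) j c j) d * v (update (update (update w i a) j c) j d) =
      ∑ a, ∑ c, (Matrix.J (Fin p) ℂ * X) a c * v (update (update w i a) j c) := by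
    simp only [Matrix.mul_apply, Finset.sum_mul, Finset.mul_sum, update_self, update_idem]
    refine Finset.sum_congr rfl fun a _ => ?_
    rw [Finset.sum_comm]
    simp only [mul_assoc]
  have h12 : (∑ a, ∑ c, (Matrix.J (Fin p) ℂ * X) a c * v (update (update w i a) j c)) +
      ∑ a, ∑ c, (X.transpose * Matrix.J (Fin p) ℂ) a c * v (update (update w i a) j c) = 0 := by
    simp only [← Finset.sum_add_distrib, ← add_mul]
    refine Finset.sum_eq_zero fun a _ => Finset.sum_eq_zero fun c _ => ?_
    have := congrFun (congrFun hX a) c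
    rw [Matrix.add_apply, add_comm] at this
    rw [this]
    simp
  rw [h1, h2, add_assoc, h12, add_zero, lieAct]
  simp only [contract, Finset.mul_sum]
  rw [Finset.sum_congr rfl fun k _ => Finset.sum_comm, Finset.sum_comm]
  refine Finset.sum_congr rfl fun a _ => ?_
  rw [Finset.sum_congr rfl fun k _ => Finset.sum_comm, Finset.sum_comm]
  refine Finset.sum_congr rfl fun c _ => Finset.sum_congr rfl fun k hk =>
    Finset.sum_congr rfl fun d _ => ?_
  have hkj : k ≠ j := (Finset.mem_erase.1 hk).1
  have hki : k ≠ i := (Finset.mem_erase.1 (Finset.mem_erase.1 hk).2).1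
  rw [update_of_ne hkj, update_of_ne hki, update_comm hkj.symm, update_comm hki.symm]
  ring

end Tensors

section Pairing

variable {α : Type*} [Fintype α] [LinearOrder α] {p : ℕ}

theorem matchTensor_one (w : α → Fin p ⊕ Fin p) : matchTensor 1 w = 1 := by
  simp [matchTensor]

theorem matchTensor_update {τ : Perm α} {i : α} (hi : τ i = i) (w : α → Fin p ⊕ Fin p)
    (c : Fin p ⊕ Fin p) : matchTensor τ (update w i c) = matchTensor τ w := by
  refine Finset.prod_congr rfl fun x hx => ?_
  have hx' : x < τ x := (Finset.mem_filter.1 hx).2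
  have h1 : x ≠ i := by
    rintro rfl
    exact absurd hx' (by rw [hi]; exact lt_irrefl _)
  have h2 : τ x ≠ i := fun h => h1 (τ.injective (h.trans hi.symm))
  rw [update_of_ne h1, update_of_ne h2]

theorem matchTensor_mul_swap {τ : Perm α} {i j : α} (hi : τ i = i) (hj : τ j = j) (hij : i < j)
    (w : α → Fin p ⊕ Fin p) :
    matchTensor (τ * Equiv.swap i j) w = Matrix.J (Fin p) ℂ (w i) (w j) * matchTensor τ w := by
  have hof : ∀ x, x ≠ i → x ≠ j → (τ * Equiv.swap i j) x = τ x := fun x h1 h2 => by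
    rw [Perm.mul_apply, swap_apply_of_ne_of_ne h1 h2]
  have hsi : (τ * Equiv.swap i j) i = j := by simp [hj]
  have hsj : (τ * Equiv.swap i j) j = i := by simp [hi]
  have hset : (univ.filter fun x => x < (τ * Equiv.swap i j) x) =
      insert i (univ.filter fun x => x < τ x) := by
    ext x
    rw [Finset.mem_filter, Finset.mem_insert, Finset.mem_filter]
    by_cases h1 : x = i
    · subst h1; simp [hij, hj]
    by_cases h2 : x = j
    · subst h2; simp [hi, hj, hij.le, h1]
    · simp [h1, swap_apply_of_ne_of_ne h1 h2]
  rw [matchTensor, hset, Finset.prod_insert (by simp [hi]), hsi, matchTensor]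
  congr 1
  refine Finset.prod_congr rfl fun x hx => ?_
  have hx' : x < τ x := (Finset.mem_filter.1 hx).2
  rw [hof x]
  · rintro rfl; rw [hi] at hx'; exact lt_irrefl _ hx'
  · rintro rfl; rw [hj] at hx'; exact lt_irrefl _ hx'

theorem sum_matchTensor_mul_contract {τ : Perm α} {i j : α} (hi : τ i = i) (hj : τ j = j)
    (hij : i ≠ j) (v : (α → Fin p ⊕ Fin p) → ℂ)
    (h0 : ∑ w, matchTensor (τ * Equiv.swap i j) w * v w = 0) :
    ∑ w, matchTensor τ w * contract i j v w = 0 := by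
  have h1 : ∑ w, Matrix.J (Fin p) ℂ (w i) (w j) * matchTensor τ w * v w = 0 := by
    rcases lt_or_gt_of_ne hij with h | h
    · simpa only [matchTensor_mul_swap hi hj h] using h0
    · rw [swap_comm] at h0
      simp only [matchTensor_mul_swap hj hi h] at h0
      simp only [fun w : α → Fin p ⊕ Fin p => J_antisymm (w i) (w j), neg_mul,
        Finset.sum_neg_distrib, h0, neg_zero]
  have h2 : ∑ w, matchTensor τ w * contract i j v w = ∑ w, ∑ a, ∑ c,
      (fun w => Matrix.J (Fin p) ℂ (w i) (w j) * matchTensor τ w * v w)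
        (update (update w i a) j c) := by
    refine Finset.sum_congr rfl fun w _ => ?_
    simp only [contract, Finset.mul_sum]
    refine Finset.sum_congr rfl fun a _ => Finset.sum_congr rfl fun c _ => ?_
    rw [matchTensor_update hj, matchTensor_update hi, update_self, update_of_ne hij, update_self]
    ring
  have h3 := sum_sum_update j
    (fun w : α → Fin p ⊕ Fin p => Matrix.J (Fin p) ℂ (w i) (w j) * matchTensor τ w * v w)
  rw [h1, mul_zero] at h3
  rw [h2, sum_sum_update i (fun w => ∑ c, (fun w => Matrix.J (Fin p) ℂ (w i) (w j) *
    matchTensor τ w * v w) (update w j c)), h3, mul_zero]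

theorem apply_eq_of_update_eq {v : (α → Fin p ⊕ Fin p) → ℂ}
    (h : ∀ w i c, v (update w i c) = v w) (w w' : α → Fin p ⊕ Fin p) : v w = v w' := by
  have key : ∀ s : Finset α, v (s.piecewise w w') = v w' := by
    intro s
    induction s using Finset.induction with
    | empty => simp
    | insert i s _ ih => rw [Finset.piecewise_insert, h, ih]
  simpa using key univ

/-- First fundamental theorem for the symplectic group in dual form: an invariant tensor that is
orthogonal to all matching tensors vanishes. -/
theorem eq_zero_of_sum_matchTensor_mul_eq_zero (A : Finset α) (v : (α → Fin p ⊕ Fin p) → ℂ)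
    (hdep : ∀ w i c, i ∉ A → v (update w i c) = v w)
    (hinv : ∀ X : Matrix (Fin p ⊕ Fin p) (Fin p ⊕ Fin p) ℂ,
      X.transpose * Matrix.J (Fin p) ℂ + Matrix.J (Fin p) ℂ * X = 0 → lieAct A X v = 0)
    (hm : ∀ σ : Perm α, (∀ x, σ (σ x) = x) → (∀ x, σ x ≠ x ↔ x ∈ A) →
      ∑ w, matchTensor σ w * v w = 0) : v = 0 := by
  induction A using Finset.strongInduction generalizing v with
  | H A ih =>
    rcases A.eq_empty_or_nonempty with rfl | hA
    · ext w
      have h := hm 1 (by simp) (by simp)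
      rw [Finset.sum_congr rfl fun w' _ => by
        rw [matchTensor_one, one_mul,
          apply_eq_of_update_eq (fun w i c => hdep w i c (by simp)) w' w]] at h
      rw [Finset.sum_const, nsmul_eq_mul] at h
      refine (mul_eq_zero.1 h).resolve_left ?_
      have : Nonempty (α → Fin p ⊕ Fin p) := ⟨w⟩
      simp only [Finset.card_univ, ne_eq, Nat.cast_eq_zero]
      exact Fintype.card_ne_zero
    · refine eq_zero_of_contract_eq_zero hA hinv fun i hi j hj hij => ?_
      refine ih ((A.erase i).erase j) ((Finset.erase_subset _ _).trans_ssubset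
        (Finset.erase_ssubset hi)) _ ?_ ?_ ?_
      · intro w k c hk
        refine Finset.sum_congr rfl fun a _ => Finset.sum_congr rfl fun d _ => ?_
        by_cases hki : k = i
        · subst hki; rw [update_idem]
        by_cases hkj : k = j
        · subst hkj; rw [update_comm hki, update_idem]
        · rw [update_comm hki, update_comm hkj, hdep]
          intro h
          exact hk (by simp [hki, hkj, h])
      · intro X hX
        rw [lieAct_contract hi hj hij v hX, hinv X hX]
        ext w
        simp only [contract, Pi.zero_apply, mul_zero, Finset.sum_const_zero]
      · intro τ hτ hsupp
        have hti : τ i = i := by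
          by_contra h
          exact absurd ((hsupp i).1 h) (by simp)
        have htj : τ j = j := by
          by_contra h
          exact absurd ((hsupp j).1 h) (by simp)
        refine sum_matchTensor_mul_contract hti htj hij v (hm _ ?_ ?_)
        · intro x
          by_cases h1 : x = i
          · subst h1; simp [hti, htj]
          by_cases h2 : x = j
          · subst h2; simp [hti, htj]
          have h3 : τ x ≠ i := fun h => h1 (τ.injective (h.trans hti.symm))
          have h4 : τ x ≠ j := fun h => h2 (τ.injective (h.trans htj.symm))
          rw [Perm.mul_apply, Perm.mul_apply, swap_apply_of_ne_of_ne h1 h2,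
            swap_apply_of_ne_of_ne h3 h4, hτ]
        · intro x
          by_cases h1 : x = i
          · subst h1; simp [htj, hi, hij.symm]
          by_cases h2 : x = j
          · subst h2; simp [hti, hj, hij]
          rw [Perm.mul_apply, swap_apply_of_ne_of_ne h1 h2, hsupp]
          simp [h1, h2]

end Pairing

section TensorPower

variable {α : Type*} [Fintype α] [LinearOrder α] {p : ℕ}

/-- The tensor power of a matrix, with tensor slots indexed by `α`. -/
def tensorPower (α : Type*) [Fintype α] (S : Matrix (Fin p ⊕ Fin p) (Fin p ⊕ Fin p) ℂ) :
    Matrix (α → Fin p ⊕ Fin p) (α → Fin p ⊕ Fin p) ℂ :=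
  Matrix.of fun w u => ∏ i, S (w i) (u i)

theorem tensorPower_mul (S T : Matrix (Fin p ⊕ Fin p) (Fin p ⊕ Fin p) ℂ) :
    tensorPower α (S * T) = tensorPower α S * tensorPower α T := by
  ext w u
  simp only [tensorPower, Matrix.of_apply, Matrix.mul_apply, ← Finset.prod_mul_distrib]
  rw [Finset.prod_univ_sum, Fintype.piFinset_univ]

theorem trace_tensorPower (S : Matrix (Fin p ⊕ Fin p) (Fin p ⊕ Fin p) ℂ) :
    (tensorPower α S).trace = S.trace ^ Fintype.card α := by
  have h := Finset.prod_univ_sum (ι := α) (fun _ => (univ : Finset (Fin p ⊕ Fin p)))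
    (fun _ c => S c c)
  rw [Fintype.piFinset_univ, Finset.prod_const, Finset.card_univ] at h
  exact h.symm

theorem sum_prod_one_mul (w : α → Fin p ⊕ Fin p) (i : α) (g : (α → Fin p ⊕ Fin p) → ℂ) :
    ∑ u, (∏ j ∈ univ.erase i, (1 : Matrix (Fin p ⊕ Fin p) (Fin p ⊕ Fin p) ℂ) (w j) (u j)) * g u =
      ∑ c, g (update w i c) := by
  have h : ∀ u, (∏ j ∈ univ.erase i, (1 : Matrix (Fin p ⊕ Fin p) (Fin p ⊕ Fin p) ℂ) (w j) (u j)) *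
      g u = if u = update w i (u i) then g u else 0 := by
    intro u
    split_ifs with hu
    · rw [Finset.prod_eq_one, one_mul]
      intro j hj
      rw [hu, update_of_ne (Finset.mem_erase.1 hj).1, Matrix.one_apply_eq]
    · obtain ⟨j, hj⟩ := Function.ne_iff.1 hu
      have hji : j ≠ i := by
        rintro rfl
        simp at hj
      rw [update_of_ne hji] at hj
      have h0 : (1 : Matrix (Fin p ⊕ Fin p) (Fin p ⊕ Fin p) ℂ) (w j) (u j) = 0 :=
        Matrix.one_apply_ne hj.symm
      exact mul_eq_zero_of_left (Finset.prod_eq_zero (Finset.mem_erase.2 ⟨hji, mem_univ j⟩) h0) _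
  rw [Finset.sum_congr rfl fun u _ => h u, ← Finset.sum_filter]
  refine Finset.sum_nbij' (fun u => u i) (fun c => update w i c) ?_ ?_ ?_ ?_ ?_
  · simp
  · simp
  · intro u hu
    exact ((Finset.mem_filter.1 hu).2).symm
  · simp
  · intro u hu
    exact congrArg g (Finset.mem_filter.1 hu).2

attribute [local instance] Matrix.linftyOpNormedRing Matrix.linftyOpNormedAlgebra

theorem hasDerivAt_exp_apply (X : Matrix (Fin p ⊕ Fin p) (Fin p ⊕ Fin p) ℂ)
    (a b : Fin p ⊕ Fin p) :
    HasDerivAt (fun t : ℝ => NormedSpace.exp (t • X) a b) (X a b) 0 := by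
  have h := hasDerivAt_exp_smul_const (𝕂 := ℝ) X 0
  rw [zero_smul, NormedSpace.exp_zero, one_mul] at h
  exact ((Matrix.entryLinearMap ℝ ℂ a b).toContinuousLinearMap.hasFDerivAt
    (x := NormedSpace.exp ((0 : ℝ) • X))).comp_hasDerivAt (0 : ℝ) h

theorem hasDerivAt_tensorPower_mulVec (X : Matrix (Fin p ⊕ Fin p) (Fin p ⊕ Fin p) ℂ)
    (v : (α → Fin p ⊕ Fin p) → ℂ) (w : α → Fin p ⊕ Fin p) :
    HasDerivAt (fun t : ℝ => (tensorPower α (NormedSpace.exp (t • X))).mulVec v w)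
      (lieAct univ X v w) 0 := by
  have h : HasDerivAt (fun t : ℝ => ∑ u, (∏ i, NormedSpace.exp (t • X) (w i) (u i)) * v u)
      (∑ u, (∑ i, (∏ j ∈ univ.erase i, NormedSpace.exp ((0 : ℝ) • X) (w j) (u j)) •
        X (w i) (u i)) * v u) 0 := by
    refine HasDerivAt.fun_sum fun u _ => HasDerivAt.mul_const ?_ _
    exact HasDerivAt.fun_finsetProd fun i _ => hasDerivAt_exp_apply X (w i) (u i)
  have he : (∑ u, (∑ i, (∏ j ∈ univ.erase i, NormedSpace.exp ((0 : ℝ) • X) (w j) (u j)) •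
        X (w i) (u i)) * v u) = lieAct univ X v w := by
    simp only [zero_smul, NormedSpace.exp_zero, Finset.sum_mul, smul_eq_mul, mul_assoc]
    rw [Finset.sum_comm, lieAct]
    refine Finset.sum_congr rfl fun i _ => ?_
    rw [sum_prod_one_mul w i (fun u => X (w i) (u i) * v u)]
    simp only [update_self]
  rw [he] at h
  exact h

theorem exp_mem_USp {X : Matrix (Fin p ⊕ Fin p) (Fin p ⊕ Fin p) ℂ}
    (hX : X.conjTranspose = -X)
    (hJ : X.transpose * Matrix.J (Fin p) ℂ + Matrix.J (Fin p) ℂ * X = 0) :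
    ∃ S : USp p, ((S : Matrix.unitaryGroup (Fin p ⊕ Fin p) ℂ) :
      Matrix (Fin p ⊕ Fin p) (Fin p ⊕ Fin p) ℂ) = NormedSpace.exp X := by
  have hinv : NormedSpace.exp (-X) * NormedSpace.exp X = 1 := by
    rw [← Matrix.exp_add_of_commute _ _ (Commute.neg_left (Commute.refl X)), neg_add_cancel,
      NormedSpace.exp_zero]
  have hu : NormedSpace.exp X ∈ Matrix.unitaryGroup (Fin p ⊕ Fin p) ℂ := by
    rw [Matrix.mem_unitaryGroup_iff', Matrix.star_eq_conjTranspose, ← Matrix.exp_conjTranspose, hX,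
      hinv]
  have hs : NormedSpace.exp X ∈ Matrix.symplecticGroup (Fin p) ℂ := by
    rw [SymplecticGroup.mem_iff']
    have hXt : X.transpose = Matrix.J (Fin p) ℂ * (-X) * (Matrix.J (Fin p) ℂ)⁻¹ := by
      have h1 : X.transpose * Matrix.J (Fin p) ℂ = Matrix.J (Fin p) ℂ * (-X) := by
        rw [mul_neg]; exact eq_neg_of_add_eq_zero_left hJ
      rw [← h1, Matrix.mul_nonsing_inv_cancel_right _ _ (Matrix.isUnit_det_J _ _)]
    rw [← Matrix.exp_transpose, hXt, Matrix.exp_conj _ _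
      ((Matrix.isUnit_iff_isUnit_det _).2 (Matrix.isUnit_det_J _ _)),
      Matrix.nonsing_inv_mul_cancel_right _ _ (Matrix.isUnit_det_J _ _), Matrix.mul_assoc, hinv,
      mul_one]
  exact ⟨⟨⟨_, hu⟩, hs⟩, rfl⟩

theorem symplectic_smul {X : Matrix (Fin p ⊕ Fin p) (Fin p ⊕ Fin p) ℂ} (z : ℂ)
    (hJ : X.transpose * Matrix.J (Fin p) ℂ + Matrix.J (Fin p) ℂ * X = 0) :
    (z • X).transpose * Matrix.J (Fin p) ℂ + Matrix.J (Fin p) ℂ * (z • X) = 0 := by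
  rw [Matrix.transpose_smul, Matrix.smul_mul, Matrix.mul_smul, ← smul_add, hJ, smul_zero]

theorem conjTranspose_J : (Matrix.J (Fin p) ℂ).conjTranspose = -Matrix.J (Fin p) ℂ := by
  ext a c
  rw [Matrix.conjTranspose_apply, star_J, J_antisymm, Matrix.neg_apply]

theorem symplectic_conjTranspose {X : Matrix (Fin p ⊕ Fin p) (Fin p ⊕ Fin p) ℂ}
    (hJ : X.transpose * Matrix.J (Fin p) ℂ + Matrix.J (Fin p) ℂ * X = 0) :
    X.conjTranspose.transpose * Matrix.J (Fin p) ℂ + Matrix.J (Fin p) ℂ * X.conjTranspose = 0 := by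
  have h := congrArg (fun M => Matrix.J (Fin p) ℂ * Matrix.conjTranspose M * Matrix.J (Fin p) ℂ) hJ
  simp only [Matrix.conjTranspose_add, Matrix.conjTranspose_mul, conjTranspose_J,
    Matrix.conjTranspose_zero, Matrix.mul_zero, Matrix.zero_mul, Matrix.mul_add,
    Matrix.add_mul] at h
  have h1 : Matrix.J (Fin p) ℂ * (-Matrix.J (Fin p) ℂ * X.transpose.conjTranspose) *
      Matrix.J (Fin p) ℂ = X.conjTranspose.transpose * Matrix.J (Fin p) ℂ := by
    rw [← Matrix.mul_assoc, mul_neg, Matrix.J_squared, neg_neg, Matrix.one_mul]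
    rfl
  have h2 : Matrix.J (Fin p) ℂ * (X.conjTranspose * -Matrix.J (Fin p) ℂ) * Matrix.J (Fin p) ℂ =
      Matrix.J (Fin p) ℂ * X.conjTranspose := by
    rw [Matrix.mul_assoc, Matrix.mul_assoc, Matrix.neg_mul, Matrix.J_squared, neg_neg,
      Matrix.mul_one]
  rwa [h1, h2] at h

theorem lieAct_eq_zero_of_invariant {v : (α → Fin p ⊕ Fin p) → ℂ}
    (hv : ∀ S : USp p, (tensorPower α ((S : Matrix.unitaryGroup (Fin p ⊕ Fin p) ℂ) :
      Matrix (Fin p ⊕ Fin p) (Fin p ⊕ Fin p) ℂ)).mulVec v = v)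
    (X : Matrix (Fin p ⊕ Fin p) (Fin p ⊕ Fin p) ℂ)
    (hJ : X.transpose * Matrix.J (Fin p) ℂ + Matrix.J (Fin p) ℂ * X = 0) :
    lieAct univ X v = 0 := by
  have hskew : ∀ Y : Matrix (Fin p ⊕ Fin p) (Fin p ⊕ Fin p) ℂ, Y.conjTranspose = -Y →
      Y.transpose * Matrix.J (Fin p) ℂ + Matrix.J (Fin p) ℂ * Y = 0 → lieAct univ Y v = 0 := by
    intro Y hY hYJ
    ext w
    refine (hasDerivAt_tensorPower_mulVec Y v w).unique ?_
    have hconst : (fun t : ℝ => (tensorPower α (NormedSpace.exp (t • Y))).mulVec v w) =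
        fun _ => v w := by
      ext t
      have hYt : t • Y = (t : ℂ) • Y := by ext; simp
      obtain ⟨S, hS⟩ := exp_mem_USp (X := t • Y)
        (by rw [Matrix.conjTranspose_smul, hY, smul_neg]; simp)
        (by rw [hYt]; exact symplectic_smul _ hYJ)
      rw [← hS, hv S]
    rw [hconst]
    exact hasDerivAt_const _ _
  have hXs := symplectic_conjTranspose hJ
  have hadd : ∀ Y Z : Matrix (Fin p ⊕ Fin p) (Fin p ⊕ Fin p) ℂ,
      Y.transpose * Matrix.J (Fin p) ℂ + Matrix.J (Fin p) ℂ * Y = 0 →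
      Z.transpose * Matrix.J (Fin p) ℂ + Matrix.J (Fin p) ℂ * Z = 0 →
      (Y + Z).transpose * Matrix.J (Fin p) ℂ + Matrix.J (Fin p) ℂ * (Y + Z) = 0 := by
    intro Y Z hY hZ
    rw [Matrix.transpose_add, Matrix.add_mul, Matrix.mul_add, add_add_add_comm, hY, hZ, add_zero]
  have h1 := hskew (X + (-1 : ℂ) • X.conjTranspose)
    (by simp [Matrix.conjTranspose_add])
    (hadd _ _ hJ (symplectic_smul _ hXs))
  have h2 := hskew (Complex.I • (X + X.conjTranspose))
    (by simp [Matrix.conjTranspose_add, Matrix.conjTranspose_smul, add_comm])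
    (symplectic_smul _ (hadd _ _ hJ hXs))
  have hX : X = (1 / 2 : ℂ) • (X + (-1 : ℂ) • X.conjTranspose) +
      (-Complex.I / 2) • (Complex.I • (X + X.conjTranspose)) := by
    ext a b
    simp only [Matrix.add_apply, Matrix.smul_apply, smul_eq_mul]
    linear_combination ((1 / 2) * (X a b + X.conjTranspose a b)) * Complex.I_mul_I
  rw [hX, lieAct_add, lieAct_smul, lieAct_smul, h1, h2]
  simp

theorem prod_eq_prod_arcs {σ : Perm α} (hσ : ∀ x, σ (σ x) = x) (hfix : ∀ x, σ x ≠ x)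
    (f : α → ℂ) : ∏ i, f i = ∏ a : {i // i < σ i}, f a * f (σ a) := by
  rw [Finset.prod_mul_distrib, ← Finset.prod_filter_mul_prod_filter_not univ (fun i => i < σ i)]
  congr 1
  · exact Finset.prod_subtype _ (by simp) f
  · rw [← Finset.prod_subtype (univ.filter fun i => i < σ i) (by simp) (fun i => f (σ i))]
    refine Finset.prod_nbij' σ σ ?_ ?_ ?_ ?_ ?_
    · intro x hx
      have : ¬ x < σ x := (Finset.mem_filter.1 hx).2
      rw [Finset.mem_filter, hσ]
      exact ⟨mem_univ _, lt_of_le_of_ne (not_lt.1 this) (hfix x)⟩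
    · intro x hx
      have : x < σ x := (Finset.mem_filter.1 hx).2
      rw [Finset.mem_filter, hσ]
      exact ⟨mem_univ _, this.le.not_gt⟩
    · intro x _; exact hσ x
    · intro x _; exact hσ x
    · intro x _; rw [hσ]

/-- A labelling of the points is a labelling of the arcs of a matching by pairs. -/
def arcLabels (σ : Perm α) (hσ : ∀ x, σ (σ x) = x) (hfix : ∀ x, σ x ≠ x) (κ : Type*) :
    (α → κ) ≃ ({i // i < σ i} → κ × κ) where
  toFun u a := (u a, u (σ a))
  invFun g j := if h : j < σ j then (g ⟨j, h⟩).1 else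
    (g ⟨σ j, by rw [hσ]; exact lt_of_le_of_ne (not_lt.1 h) (hfix j)⟩).2
  left_inv u := by
    ext j
    by_cases h : j < σ j <;> simp [h, hσ]
  right_inv g := by
    ext ⟨a, ha⟩
    · simp [ha]
    · have h : ¬ σ a < σ (σ a) := by rw [hσ]; exact ha.le.not_gt
      have h' : ∀ b (hb : b < σ b), b = a → (g ⟨b, hb⟩).2 = (g ⟨a, ha⟩).2 := by
        rintro b hb rfl
        rfl
      simp only [dif_neg h]
      exact h' _ _ (hσ a)

theorem tensorPower_mulVec_matchTensor {σ : Perm α} (hσ : ∀ x, σ (σ x) = x)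
    (hfix : ∀ x, σ x ≠ x) (S : USp p) :
    (tensorPower α ((S : Matrix.unitaryGroup (Fin p ⊕ Fin p) ℂ) :
      Matrix (Fin p ⊕ Fin p) (Fin p ⊕ Fin p) ℂ)).mulVec (matchTensor σ) = matchTensor σ := by
  have hS : ∀ x y, ∑ z : (Fin p ⊕ Fin p) × (Fin p ⊕ Fin p),
      (S : Matrix.unitaryGroup (Fin p ⊕ Fin p) ℂ) x z.1 *
        (S : Matrix.unitaryGroup (Fin p ⊕ Fin p) ℂ) y z.2 * Matrix.J (Fin p) ℂ z.1 z.2 =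
      Matrix.J (Fin p) ℂ x y := by
    intro x y
    have h := congrFun (congrFun (SymplecticGroup.mem_iff.1 S.2) x) y
    rw [← h, Fintype.sum_prod_type, Finset.sum_comm]
    simp only [Matrix.mul_apply, Matrix.transpose_apply, Finset.sum_mul]
    refine Finset.sum_congr rfl fun c _ => Finset.sum_congr rfl fun d _ => ?_
    ring
  have hmt : ∀ w : α → Fin p ⊕ Fin p, matchTensor σ w =
      ∏ a : {i // i < σ i}, Matrix.J (Fin p) ℂ (w a) (w (σ a)) := fun w =>
    Finset.prod_subtype _ (by simp) (fun i => Matrix.J (Fin p) ℂ (w i) (w (σ i)))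
  ext w
  let f : {i // i < σ i} → (Fin p ⊕ Fin p) × (Fin p ⊕ Fin p) → ℂ := fun a z =>
    (S : Matrix.unitaryGroup (Fin p ⊕ Fin p) ℂ) (w a) z.1 *
      (S : Matrix.unitaryGroup (Fin p ⊕ Fin p) ℂ) (w (σ a)) z.2 * Matrix.J (Fin p) ℂ z.1 z.2
  have hterm : ∀ u, tensorPower α (S : Matrix.unitaryGroup (Fin p ⊕ Fin p) ℂ).1 w u *
      matchTensor σ u = ∏ a, f a (arcLabels σ hσ hfix _ u a) := by
    intro u
    rw [hmt, tensorPower, Matrix.of_apply, prod_eq_prod_arcs hσ hfix, ← Finset.prod_mul_distrib]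
    rfl
  have hprod := Finset.prod_univ_sum (fun _ : {i // i < σ i} => univ) f
  rw [Fintype.piFinset_univ] at hprod
  rw [Matrix.mulVec, dotProduct, Finset.sum_congr rfl fun u _ => hterm u,
    (arcLabels σ hσ hfix (Fin p ⊕ Fin p)).sum_comp (fun g => ∏ a, f a (g a)), ← hprod, hmt]
  exact Finset.prod_congr rfl fun a _ => hS _ _

end TensorPower

section Haar

variable {α : Type*} [Fintype α] [LinearOrder α] {p : ℕ}

/-- The invariants of `USp(2p)` in the tensor power with slots indexed by `α`. -/
def invariants (α : Type*) [Fintype α] [DecidableEq α] (p : ℕ) :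
    Submodule ℂ ((α → Fin p ⊕ Fin p) → ℂ) where
  carrier := {v | ∀ S : USp p, (tensorPower α ((S : Matrix.unitaryGroup (Fin p ⊕ Fin p) ℂ) :
    Matrix (Fin p ⊕ Fin p) (Fin p ⊕ Fin p) ℂ)).mulVec v = v}
  add_mem' hu hv S := by rw [Matrix.mulVec_add, hu S, hv S]
  zero_mem' S := Matrix.mulVec_zero _
  smul_mem' z v hv S := by rw [Matrix.mulVec_smul, hv S]

theorem mem_invariants {v : (α → Fin p ⊕ Fin p) → ℂ} :
    v ∈ invariants α p ↔ ∀ S : USp p,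
      (tensorPower α ((S : Matrix.unitaryGroup (Fin p ⊕ Fin p) ℂ) :
        Matrix (Fin p ⊕ Fin p) (Fin p ⊕ Fin p) ℂ)).mulVec v = v :=
  Iff.rfl

theorem integrable_tensorPower [MeasurableSpace (USp p)] [BorelSpace (USp p)]
    (μ : Measure (USp p)) [IsFiniteMeasure μ] (w u : α → Fin p ⊕ Fin p) :
    Integrable (fun S : USp p => tensorPower α ((S : Matrix.unitaryGroup (Fin p ⊕ Fin p) ℂ) :
      Matrix (Fin p ⊕ Fin p) (Fin p ⊕ Fin p) ℂ) w u) μ := by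
  have hcont : Continuous fun S : USp p => tensorPower α
      ((S : Matrix.unitaryGroup (Fin p ⊕ Fin p) ℂ) :
        Matrix (Fin p ⊕ Fin p) (Fin p ⊕ Fin p) ℂ) w u := by
    refine continuous_finsetProd _ fun i _ => ?_
    exact (continuous_subtype_val.comp continuous_subtype_val).matrix_elem (w i) (u i)
  refine Integrable.of_bound hcont.measurable.aestronglyMeasurable 1
    (Filter.Eventually.of_forall fun S => ?_)
  rw [tensorPower, Matrix.of_apply, norm_prod]
  exact Finset.prod_le_one (fun i _ => norm_nonneg _)
    fun i _ => entry_norm_bound_of_unitary S.1.2 (w i) (u i)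

theorem integral_trace_pow_eq_finrank [MeasurableSpace (USp p)] [BorelSpace (USp p)]
    (μ : Measure (USp p)) [μ.IsHaarMeasure] [IsProbabilityMeasure μ] :
    ∫ S : USp p, (Matrix.trace ((S : Matrix.unitaryGroup (Fin p ⊕ Fin p) ℂ) :
      Matrix (Fin p ⊕ Fin p) (Fin p ⊕ Fin p) ℂ)) ^ Fintype.card α ∂μ =
      (Module.finrank ℂ (invariants α p) : ℂ) := by
  let K : USp p → Matrix (α → Fin p ⊕ Fin p) (α → Fin p ⊕ Fin p) ℂ := fun S =>
    tensorPower α ((S : Matrix.unitaryGroup (Fin p ⊕ Fin p) ℂ) :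
      Matrix (Fin p ⊕ Fin p) (Fin p ⊕ Fin p) ℂ)
  have hK : ∀ S T, K (S * T) = K S * K T := fun S T => tensorPower_mul _ _
  have hint : ∀ w u, Integrable (fun S => K S w u) μ := integrable_tensorPower μ
  let M : Matrix (α → Fin p ⊕ Fin p) (α → Fin p ⊕ Fin p) ℂ := Matrix.of fun w u => ∫ S, K S w u ∂μ
  have hintv : ∀ v w, Integrable (fun S => (K S).mulVec v w) μ := fun v w =>
    integrable_finsetSum _ fun u _ => (hint w u).mul_const _
  have hM : ∀ v w, M.mulVec v w = ∫ S, (K S).mulVec v w ∂μ := by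
    intro v w
    simp only [Matrix.mulVec, dotProduct]
    rw [integral_finsetSum _ fun u _ => (hint w u).mul_const _]
    refine Finset.sum_congr rfl fun u _ => ?_
    rw [integral_mul_const]
    rfl
  have hproj : LinearMap.IsProj (invariants α p) M.mulVecLin := by
    refine ⟨fun v T => ?_, fun v hv => ?_⟩
    · ext w
      change (K T).mulVec (M.mulVec v) w = M.mulVec v w
      have h1 : (K T).mulVec (M.mulVec v) w = ∫ S, (K T).mulVec ((K S).mulVec v) w ∂μ := by
        rw [Matrix.mulVec, dotProduct]
        simp only [hM]
        simp only [← integral_const_mul]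
        rw [← integral_finsetSum _ fun u _ => (hintv v u).const_mul _]
        rfl
      rw [h1, hM]
      simp only [Matrix.mulVec_mulVec, ← hK]
      exact integral_mul_left_eq_self (fun S => (K S).mulVec v w) T
    · ext w
      rw [Matrix.mulVecLin_apply, hM]
      have : ∀ S, (K S).mulVec v = v := hv
      simp [this]
  rw [← hproj.trace, ← Matrix.toLin'_apply', Matrix.trace_toLin'_eq, Matrix.trace]
  simp only [M, Matrix.diag_apply, Matrix.of_apply]
  rw [← integral_finsetSum _ fun u _ => hint u u]
  refine integral_congr_ae (Filter.Eventually.of_forall fun S => ?_)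
  exact (trace_tensorPower _).symm

end Haar

section Straightening

variable {α : Type*} [Fintype α] [LinearOrder α] {p n : ℕ}

/-- The sign picked up when an involution `σ` is conjugated by `ρ`: the parity of the number of
arcs of `σ` whose orientation is reversed by `ρ`. -/
def arcSign (ρ σ : Perm α) : ℤˣ :=
  ∏ i with i < σ i, if ρ i < ρ (σ i) then 1 else -1

theorem matchTensor_comp {σ : Perm α} (hσ : ∀ x, σ (σ x) = x) (ρ : Perm α)
    (w : α → Fin p ⊕ Fin p) :
    matchTensor σ (w ∘ ρ) = ((arcSign ρ σ : ℤ) : ℂ) * matchTensor (ρ * σ * ρ⁻¹) w := by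
  have h : ∏ i with i < σ i, Matrix.J (Fin p) ℂ (w (min (ρ i) (ρ (σ i))))
        (w (max (ρ i) (ρ (σ i)))) = matchTensor (ρ * σ * ρ⁻¹) w := by
    have hτ : ∀ i, (ρ * σ * ρ⁻¹) i = ρ (σ (ρ.symm i)) := fun _ => rfl
    simp only [matchTensor, hτ]
    refine Finset.prod_nbij' (fun i => min (ρ i) (ρ (σ i)))
      (fun j => min (ρ.symm j) (σ (ρ.symm j))) ?_ ?_ ?_ ?_ ?_
    · intro i hi
      refine mem_filter.2 ⟨mem_univ _, ?_⟩
      have hne : ρ i ≠ ρ (σ i) := fun h => (mem_filter.1 hi).2.ne (ρ.injective h)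
      rcases hne.lt_or_gt with h | h
      · simpa [min_eq_left h.le] using h
      · simpa [min_eq_right h.le, hσ] using h
    · intro j hj
      refine mem_filter.2 ⟨mem_univ _, ?_⟩
      have hne : ρ.symm j ≠ σ (ρ.symm j) := fun h => by
        have := (mem_filter.1 hj).2
        rw [← h] at this
        simp at this
      rcases hne.lt_or_gt with h | h
      · simpa only [min_eq_left h.le] using h
      · simpa only [min_eq_right h.le, hσ] using h
    · intro i hi
      have hi' := (mem_filter.1 hi).2
      rcases le_total (ρ i) (ρ (σ i)) with h | h
      · simp [min_eq_left h, hi'.le]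
      · simp [min_eq_right h, hσ, hi'.le]
    · intro j hj
      have hj' := (mem_filter.1 hj).2
      rcases le_total (ρ.symm j) (σ (ρ.symm j)) with h | h
      · simp [min_eq_left h, hj'.le]
      · simp [min_eq_right h, hσ, hj'.le]
    · intro i hi
      rcases le_total (ρ i) (ρ (σ i)) with h | h
      · simp [min_eq_left h, max_eq_right h]
      · simp [min_eq_right h, max_eq_left h, hσ]
  rw [← h, arcSign, Units.coe_prod, Int.cast_prod, ← Finset.prod_mul_distrib, matchTensor]
  refine Finset.prod_congr rfl fun i hi => ?_
  by_cases h : ρ i < ρ (σ i)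
  · simp [h, h.le]
  · have h' := not_lt.1 h
    simp only [comp_apply, h, if_false, min_eq_right h', max_eq_left h']
    rw [J_antisymm]
    simp

/-- The extension of a permutation of the positions of `t` to all of `α`. -/
abbrev extendAlong (t : Fin n ↪o α) (π : Perm (Fin n)) : Perm α :=
  π.viaFintypeEmbedding t.toEmbedding

theorem extendAlong_apply (t : Fin n ↪o α) (π : Perm (Fin n)) (a : Fin n) :
    extendAlong t π (t a) = t (π a) :=
  π.viaFintypeEmbedding_apply_image t.toEmbedding a

theorem extendAlong_apply_of_notMem (t : Fin n ↪o α) (π : Perm (Fin n)) {x : α}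
    (hx : x ∉ Set.range t) : extendAlong t π x = x :=
  π.viaFintypeEmbedding_apply_notMem_range t.toEmbedding hx

theorem extendAlong_inv_apply (t : Fin n ↪o α) (π : Perm (Fin n)) (a : Fin n) :
    (extendAlong t π)⁻¹ (t a) = t (π⁻¹ a) := by
  rw [Perm.inv_eq_iff_eq, extendAlong_apply]
  simp

theorem extendAlong_inv_apply_of_notMem (t : Fin n ↪o α) (π : Perm (Fin n)) {x : α}
    (hx : x ∉ Set.range t) : (extendAlong t π)⁻¹ x = x := by
  rw [Perm.inv_eq_iff_eq, extendAlong_apply_of_notMem t π hx]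

/-- Antisymmetrising a tensor over more slots than the dimension gives zero. -/
theorem sum_sign_mul_comp_extendAlong_eq_zero (t : Fin n ↪o α) (hn : 2 * p < n)
    (f : (α → Fin p ⊕ Fin p) → ℂ) (w : α → Fin p ⊕ Fin p) :
    ∑ π : Perm (Fin n), ((Perm.sign π : ℤ) : ℂ) * f (w ∘ extendAlong t π) = 0 := by
  obtain ⟨a, b, hab, hw⟩ := Fintype.exists_ne_map_eq_of_card_lt (w ∘ t)
    (by simpa [← two_mul] using hn)
  have hs : ∀ c, w (t (Equiv.swap a b c)) = w (t c) := by
    intro c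
    rcases eq_or_ne c a with rfl | ha
    · simpa using hw.symm
    rcases eq_or_ne c b with rfl | hb
    · simpa using hw
    rw [Equiv.swap_apply_of_ne_of_ne ha hb]
  have hcomp : ∀ π, w ∘ extendAlong t (Equiv.swap a b * π) = w ∘ extendAlong t π := by
    intro π
    funext x
    by_cases hx : x ∈ Set.range t
    · obtain ⟨c, rfl⟩ := hx
      simp only [comp_apply, extendAlong_apply, Perm.mul_apply, hs]
    · simp only [comp_apply, extendAlong_apply_of_notMem t _ hx]
  refine Finset.sum_involution (fun π _ => Equiv.swap a b * π) ?_ ?_ ?_ ?_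
  · intro π _
    rw [hcomp, Perm.sign_mul, Perm.sign_swap hab]
    simp
  · intro π _ _ h
    exact hab (Equiv.swap_eq_one_iff.1 (mul_eq_right.1 h))
  · simp
  · intro π _
    rw [← mul_assoc, Equiv.swap_mul_self, one_mul]

variable {σ : Perm α} {t : Fin n ↪o α}

theorem apply_notMem_range (hσ : ∀ x, σ (σ x) = x) (ht : ∀ a, σ (t a) = t a.rev) {x : α}
    (hx : x ∉ Set.range t) : σ x ∉ Set.range t := by
  rintro ⟨b, hb⟩
  exact hx ⟨b.rev, by rw [← ht, hb, hσ]⟩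

/-- A permutation of a nest of arcs which preserves the arcs has sign equal to the parity of
the number of arcs it flips. -/
theorem arcSign_extendAlong_eq_sign (hσ : ∀ x, σ (σ x) = x) (ht : ∀ a, σ (t a) = t a.rev)
    {π : Perm (Fin n)} (hπ : ∀ a, π a.rev = (π a).rev) :
    arcSign (extendAlong t π) σ = Perm.sign π := by
  have h1 : arcSign (extendAlong t π) σ =
      ∏ a : Fin n with a < a.rev, if π a < π a.rev then (1 : ℤˣ) else -1 := by
    rw [arcSign]
    symm
    refine Finset.prod_of_injOn t t.injective.injOn ?_ ?_ ?_
    · intro a ha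
      simpa [ht] using ha
    · intro x hx hxt
      have hr : x ∉ Set.range t := by
        rintro ⟨a, rfl⟩
        refine hxt ⟨a, ?_, rfl⟩
        simpa [ht] using hx
      rw [extendAlong_apply_of_notMem t π hr,
        extendAlong_apply_of_notMem t π (apply_notMem_range hσ ht hr), if_pos (mem_filter.1 hx).2]
    · intro a _
      simp only [ht, extendAlong_apply, t.lt_iff_lt]
  have h2 : Perm.sign π = ∏ x : Fin n × Fin n with x.1 < x.2,
      if π x.1 < π x.2 then (1 : ℤˣ) else -1 := by
    rw [Perm.sign_eq_prod_prod_Iio, Finset.prod_filter, Fintype.prod_prod_type_right]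
    refine Finset.prod_congr rfl fun j _ => ?_
    rw [← Finset.prod_filter]
    refine Finset.prod_congr ?_ fun _ _ => rfl
    ext i
    simp
  have h3 : ∏ x : Fin n × Fin n with x.1 < x.2 ∧ x.2 ≠ x.1.rev,
      (if π x.1 < π x.2 then (1 : ℤˣ) else -1) = 1 := by
    refine Finset.prod_involution (fun x _ => (x.2.rev, x.1.rev)) ?_ ?_ ?_ ?_
    · rintro ⟨a, b⟩ _
      simp only [hπ, Fin.rev_lt_rev]
      split_ifs <;> simp
    · rintro ⟨a, b⟩ hx _ h
      simp only [mem_filter, mem_univ, true_and] at hx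
      exact hx.2 (Prod.ext_iff.1 h).2.symm
    · rintro ⟨a, b⟩ hx
      simp only [mem_filter, mem_univ, true_and, Fin.rev_lt_rev, Fin.rev_rev] at hx ⊢
      exact ⟨hx.1, fun h => hx.2 (by rw [h])⟩
    · rintro ⟨a, b⟩ _
      simp
  rw [h1, h2, ← Finset.prod_filter_mul_prod_filter_not _ (fun x : Fin n × Fin n => x.2 ≠ x.1.rev),
    Finset.filter_filter, h3, one_mul, Finset.filter_filter]
  refine Finset.prod_nbij' (fun a => (a, a.rev)) (fun x => x.1) ?_ ?_ ?_ ?_ ?_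
  · intro a ha
    simpa using ha
  · rintro ⟨a, b⟩ hx
    simp only [mem_filter, mem_univ, true_and, not_not] at hx ⊢
    exact hx.2 ▸ hx.1
  · intro a _
    rfl
  · rintro ⟨a, b⟩ hx
    simp only [mem_filter, mem_univ, true_and, not_not] at hx
    rw [hx.2]
  · intro a _
    rfl

theorem conj_extendAlong_apply (ht : ∀ a, σ (t a) = t a.rev) (π : Perm (Fin n)) (a : Fin n) :
    (extendAlong t π * σ * (extendAlong t π)⁻¹) (t a) = t (π (π⁻¹ a).rev) := by
  rw [Perm.mul_apply, Perm.mul_apply, extendAlong_inv_apply, ht, extendAlong_apply]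

/-- Rearranging a nest of arcs decreases the involution lexicographically. -/
theorem conj_extendAlong_toLex_lt (hσ : ∀ x, σ (σ x) = x) (ht : ∀ a, σ (t a) = t a.rev)
    {π : Perm (Fin n)} (hne : extendAlong t π * σ * (extendAlong t π)⁻¹ ≠ σ) :
    toLex (⇑(extendAlong t π * σ * (extendAlong t π)⁻¹)) < toLex (⇑σ) := by
  set τ := extendAlong t π * σ * (extendAlong t π)⁻¹ with hτ
  have hex : ∃ x, τ x ≠ σ x := by
    by_contra! h
    exact hne (Equiv.ext h)
  obtain ⟨x, hx, hmin⟩ := WellFounded.has_min (wellFounded_lt (α := α)) {x | τ x ≠ σ x} hex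
  have hlow : ∀ y < x, τ y = σ y := fun y hy => by_contra fun h => hmin y h hy
  refine ⟨x, hlow, ?_⟩
  have hr : x ∈ Set.range t := by
    by_contra hr
    apply hx
    rw [hτ, Perm.mul_apply, Perm.mul_apply, extendAlong_inv_apply_of_notMem t π hr,
      extendAlong_apply_of_notMem t π (apply_notMem_range hσ ht hr)]
  obtain ⟨a, rfl⟩ := hr
  have hle : ∀ a' ≤ a, π (π⁻¹ a).rev ≠ a'.rev := by
    intro a' ha' h
    have hta : τ (t a) = t a'.rev := by rw [hτ, conj_extendAlong_apply ht, h]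
    rcases ha'.eq_or_lt with rfl | hlt
    · exact hx (by rw [hta, ht])
    · have := hlow (t a') (t.lt_iff_lt.2 hlt)
      rw [ht, ← hta] at this
      exact hlt.ne (t.injective (τ.injective this))
  have hb : a < (π (π⁻¹ a).rev).rev := by
    by_contra h
    exact hle _ (not_lt.1 h) (Fin.rev_rev _).symm
  change τ (t a) < σ (t a)
  rw [hτ, conj_extendAlong_apply ht, ht, t.lt_iff_lt, ← Fin.rev_lt_rev]
  simpa using hb

/-- A tensor paired trivially with all matchings without a large nest is paired trivially with
all matchings. -/
theorem sum_matchTensor_mul_eq_zero_of_nest (hn : 2 * p < n) {v : (α → Fin p ⊕ Fin p) → ℂ}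
    (hv : ∀ σ : Perm α, (∀ x, σ (σ x) = x) → (∀ x, σ x ≠ x) →
      (¬ ∃ t : Fin n ↪o α, ∀ a, σ (t a) = t a.rev) → ∑ w, matchTensor σ w * v w = 0)
    (σ : Perm α) (hσ : ∀ x, σ (σ x) = x) (hfix : ∀ x, σ x ≠ x) :
    ∑ w, matchTensor σ w * v w = 0 := by
  have hwf : WellFounded fun σ τ : Perm α => toLex (⇑σ) < toLex (⇑τ) :=
    InvImage.wf (fun σ : Perm α => toLex (⇑σ)) wellFounded_lt
  induction σ using hwf.induction with
  | _ σ ih =>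
  by_cases hnest : ∃ t : Fin n ↪o α, ∀ a, σ (t a) = t a.rev
  swap
  · exact hv σ hσ hfix hnest
  obtain ⟨t, ht⟩ := hnest
  have key : ∑ π : Perm (Fin n), ((Perm.sign π : ℤ) : ℂ) *
      (((arcSign (extendAlong t π) σ : ℤ) : ℂ) *
        ∑ w, matchTensor (extendAlong t π * σ * (extendAlong t π)⁻¹) w * v w) = 0 := by
    calc _ = ∑ w, (∑ π : Perm (Fin n), ((Perm.sign π : ℤ) : ℂ) *
          matchTensor σ (w ∘ extendAlong t π)) * v w := by
          simp only [matchTensor_comp hσ, Finset.mul_sum, Finset.sum_mul]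
          rw [Finset.sum_comm]
          simp only [mul_assoc]
      _ = 0 := by simp [sum_sign_mul_comp_extendAlong_eq_zero t hn]
  have hterm : ∀ π : Perm (Fin n), ((Perm.sign π : ℤ) : ℂ) *
      (((arcSign (extendAlong t π) σ : ℤ) : ℂ) *
        ∑ w, matchTensor (extendAlong t π * σ * (extendAlong t π)⁻¹) w * v w) =
      if extendAlong t π * σ * (extendAlong t π)⁻¹ = σ then ∑ w, matchTensor σ w * v w
        else 0 := by
    intro π
    split_ifs with h
    · have hπ : ∀ a, π a.rev = (π a).rev := by
        intro a
        have := conj_extendAlong_apply ht π (π a)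
        rw [h, ht, show π⁻¹ (π a) = a from π.symm_apply_apply a] at this
        exact (t.injective this).symm
      rw [arcSign_extendAlong_eq_sign hσ ht hπ, h, ← mul_assoc, ← Int.cast_mul, ← Units.val_mul,
        Int.units_mul_self]
      simp
    · rw [ih _ (conj_extendAlong_toLex_lt hσ ht h) (fun x => by simp [hσ]) ?_]
      · simp
      · intro x hx
        simp only [Perm.mul_apply] at hx
        exact hfix _ (Perm.eq_inv_iff_eq.2 hx)
  rw [Finset.sum_congr rfl fun π _ => hterm π, ← Finset.sum_filter, Finset.sum_const,
    nsmul_eq_mul, mul_eq_zero] at key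
  refine key.resolve_left (Nat.cast_ne_zero.2 (Finset.card_ne_zero.2 ⟨1, ?_⟩))
  have h1 : extendAlong t 1 = 1 := by
    ext x
    by_cases hx : x ∈ Set.range t
    · obtain ⟨a, rfl⟩ := hx
      simp [extendAlong_apply]
    · simp [extendAlong_apply_of_notMem t 1 hx]
  simp [h1]

end Straightening

section Nests

variable {α : Type*} [LinearOrder α] {p : ℕ} {σ : Perm α}

/-- Nested arcs `i 0 < i 1 < ⋯ < σ (i 1) < σ (i 0)` listed as an increasing sequence of points. -/
theorem exists_nest (hσ : ∀ x, σ (σ x) = x) {i : Fin (p + 1) → α} (hi : StrictMono i)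
    (hi' : StrictAnti (σ ∘ i)) (hlt : i (Fin.last p) < σ (i (Fin.last p))) :
    ∃ t : Fin (2 * (p + 1)) ↪o α, ∀ a, σ (t a) = t a.rev := by
  have hall : ∀ l m, i l < σ (i m) := fun l m =>
    (hi.monotone (Fin.le_last l)).trans_lt (hlt.trans_le (hi'.antitone (Fin.le_last m)))
  let f : Fin (2 * (p + 1)) → α := fun a =>
    if h : a.1 < p + 1 then i ⟨a, h⟩ else σ (i ⟨a.rev, by rw [Fin.val_rev]; omega⟩)
  have hf : StrictMono f := by
    intro a b hab
    have hab' : a.1 < b.1 := hab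
    by_cases ha : a.1 < p + 1 <;> by_cases hb : b.1 < p + 1
    · simp only [f, ha, hb, dif_pos]
      exact hi hab'
    · simp only [f, ha, hb, dif_pos, dif_neg, not_false_eq_true]
      exact hall _ _
    · omega
    · simp only [f, ha, hb, dif_neg, not_false_eq_true]
      refine hi' ?_
      rw [Fin.mk_lt_mk, Fin.val_rev, Fin.val_rev]
      omega
  refine ⟨OrderEmbedding.ofStrictMono f hf, fun a => ?_⟩
  change σ (f a) = f a.rev
  by_cases ha : a.1 < p + 1
  · have hr : ¬ a.rev.1 < p + 1 := by rw [Fin.val_rev]; omega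
    simp only [f, ha, hr, dif_pos, dif_neg, not_false_eq_true, Fin.rev_rev]
  · have hr : a.rev.1 < p + 1 := by rw [Fin.val_rev]; omega
    simp only [f, ha, hr, dif_pos, dif_neg, not_false_eq_true, hσ]

theorem exists_nest_of_decreasing (hσ : ∀ x, σ (σ x) = x) (hfix : ∀ x, σ x ≠ x) {q : ℕ}
    (hq : 2 * p < q) {t : Fin q → α} (ht : StrictMono t) (ht' : StrictAnti fun a => σ (t a)) :
    ∃ t : Fin (2 * (p + 1)) ↪o α, ∀ a, σ (t a) = t a.rev := by
  rcases (hfix (t ⟨p, by omega⟩)).lt_or_gt with h | h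
  · refine exists_nest hσ (i := fun l => σ (t ⟨2 * p - l, by omega⟩)) ?_ ?_ ?_
    · intro a b hab
      have : a.1 < b.1 := hab
      refine ht' ?_
      rw [Fin.mk_lt_mk]
      omega
    · intro a b hab
      have : a.1 < b.1 := hab
      simp only [comp_apply, hσ]
      refine ht ?_
      rw [Fin.mk_lt_mk]
      omega
    · have hp : 2 * p - (Fin.last p).1 = p := by rw [Fin.val_last]; omega
      simpa only [hp, hσ] using h
  · exact exists_nest hσ (i := fun l => t ⟨l, by omega⟩) (fun a b hab => ht hab)
      (fun a b hab => ht' hab) h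

/-- The arcs of a matching without a nest of `p + 1` arcs can be coloured with `p` colours such
that arcs of the same colour are not nested. -/
theorem exists_coloring (hσ : ∀ x, σ (σ x) = x)
    (hnest : ¬ ∃ t : Fin (2 * (p + 1)) ↪o α, ∀ a, σ (t a) = t a.rev) :
    ∃ col : {x : α // x < σ x} → Fin p, ∀ x y, x < y → col x = col y → σ x < σ y := by
  let P := {y : α × αᵒᵈ // y.1 < σ y.1 ∧ y.2 = OrderDual.toDual (σ y.1)}
  let arc : {x : α // x < σ x} → P := fun x => ⟨(x, OrderDual.toDual (σ x)), x.2, rfl⟩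
  have hP : ∀ {y z : P}, y < z → y.1.1 < z.1.1 ∧ σ z.1.1 < σ y.1.1 := by
    intro y z hyz
    have h1 : y.1.1 ≤ z.1.1 := hyz.le.1
    have hne : y.1.1 ≠ z.1.1 := by
      intro h
      refine hyz.ne (Subtype.ext (Prod.ext h ?_))
      rw [y.2.2, z.2.2, h]
    have h2 : σ z.1.1 ≤ σ y.1.1 := by
      have : y.1.2 ≤ z.1.2 := hyz.le.2
      rw [y.2.2, z.2.2] at this
      exact this
    exact ⟨h1.lt_of_ne hne, h2.lt_of_ne fun h => hne (σ.injective h).symm⟩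
  have hlt : ∀ y : P, Order.height y < p := by
    intro y
    by_contra! h
    obtain ⟨s, -, hs⟩ := Order.exists_series_of_le_height y h
    subst hs
    exact hnest (exists_nest hσ (i := fun l => (s l).1.1)
      (fun a b hab => (hP (s.strictMono hab)).1) (fun a b hab => (hP (s.strictMono hab)).2)
      (s _).2.1)
  have hcoe : ∀ y : P, ((Order.height y).toNat : ℕ∞) = Order.height y := fun y =>
    ENat.natCast_toNat (hlt y).ne_top
  refine ⟨fun x => ⟨(Order.height (arc x)).toNat, ?_⟩, fun x y hxy hcol => ?_⟩
  · have := hlt (arc x)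
    rw [← hcoe] at this
    exact_mod_cast this
  · by_contra h
    have harc : arc x < arc y := by
      refine lt_of_le_of_ne ⟨hxy.le, not_lt.1 h⟩ fun he => hxy.ne (Subtype.ext ?_)
      exact congrArg (fun z : P => z.1.1) he
    have := Order.height_strictMono harc (lt_of_lt_of_le (hlt _) le_top)
    rw [← hcoe (arc x), ← hcoe (arc y), Fin.mk.inj_iff.1 hcol] at this
    exact lt_irrefl _ this

end Nests

section Independence

variable {α : Type*} [Fintype α] [LinearOrder α] {p : ℕ}

theorem apply_eq_swap_of_matchTensor_ne_zero {τ : Perm α} (hτ : ∀ x, τ (τ x) = x)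
    {w : α → Fin p ⊕ Fin p} (h : matchTensor τ w ≠ 0) {x : α} (hx : τ x ≠ x) :
    w (τ x) = (w x).swap := by
  have h' : ∀ y, y < τ y → w (τ y) = (w y).swap := fun y hy =>
    (J_ne_zero_iff _ _).1 (Finset.prod_ne_zero_iff.1 h y (by simpa using hy))
  rcases hx.lt_or_gt with hlt | hlt
  · have := h' (τ x) (by rwa [hτ])
    rw [hτ] at this
    rw [this, Sum.swap_swap]
  · exact h' x hlt

/-- A matching without a large nest has a word that detects it among all matchings which are not
lexicographically larger. -/
theorem exists_word {σ : Perm α} (hσ : ∀ x, σ (σ x) = x) (hfix : ∀ x, σ x ≠ x)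
    (hnest : ¬ ∃ t : Fin (2 * (p + 1)) ↪o α, ∀ a, σ (t a) = t a.rev) :
    ∃ w : α → Fin p ⊕ Fin p, matchTensor σ w ≠ 0 ∧
      ∀ τ : Perm α, (∀ x, τ (τ x) = x) → (∀ x, τ x ≠ x) → matchTensor τ w ≠ 0 → τ ≠ σ →
        toLex (⇑σ) < toLex (⇑τ) := by
  obtain ⟨col, hcol⟩ := exists_coloring hσ hnest
  have hclose : ∀ {x}, ¬ x < σ x → σ x < σ (σ x) := fun {x} h => by
    rw [hσ]
    exact (not_lt.1 h).lt_of_ne (hfix x)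
  let w : α → Fin p ⊕ Fin p := fun x =>
    if h : x < σ x then Sum.inl (col ⟨x, h⟩) else Sum.inr (col ⟨σ x, hclose h⟩)
  refine ⟨w, Finset.prod_ne_zero_iff.2 fun x hx => ?_, fun τ hτ hτfix hne hτσ => ?_⟩
  · have hx' : x < σ x := (mem_filter.1 hx).2
    rw [J_ne_zero_iff]
    simp only [w, hx', hx'.not_gt, dif_pos, dif_neg, not_false_eq_true, Sum.swap_inl, hσ]
  have hex : ∃ x, τ x ≠ σ x := by
    by_contra! h
    exact hτσ (Equiv.ext h)
  obtain ⟨x, hx, hmin⟩ := WellFounded.has_min (wellFounded_lt (α := α)) {x | τ x ≠ σ x} hex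
  have hlow : ∀ y < x, σ y = τ y := fun y hy => by_contra fun h => hmin y (Ne.symm h) hy
  refine ⟨x, hlow, ?_⟩
  change σ x < τ x
  have hop : x < σ x := by
    by_contra h
    have h1 := hlow (σ x) ((not_lt.1 h).lt_of_ne (hfix x))
    rw [hσ] at h1
    exact hx ((congrArg τ h1).trans (hτ _))
  have hw := apply_eq_swap_of_matchTensor_ne_zero hτ hne (hτfix x)
  have hcl : ¬ τ x < σ (τ x) := fun h => by
    simp [w, hop, h] at hw
  simp only [w, hop, hcl, dif_pos, dif_neg, not_false_eq_true, Sum.swap_inl,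
    Sum.inr.injEq] at hw
  rcases lt_trichotomy (σ (τ x)) x with h | h | h
  · have h1 := hlow _ h
    rw [hσ] at h1
    exact absurd (τ.injective h1).symm h.ne
  · refine absurd ?_ hx
    rw [← hσ (τ x), h]
  · have := hcol ⟨x, hop⟩ ⟨σ (τ x), hclose hcl⟩ h hw.symm
    simpa only [hσ] using this

variable (α p) in
/-- The matchings of `α` without a nest of `p + 1` arcs. -/
def NestFree : Type _ :=
  {σ : Perm α // (∀ x, σ (σ x) = x) ∧ (∀ x, σ x ≠ x) ∧
    ¬ ∃ t : Fin (2 * (p + 1)) ↪o α, ∀ a, σ (t a) = t a.rev}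

noncomputable instance : Fintype (NestFree α p) := by
  classical
  exact inferInstanceAs (Fintype {σ : Perm α // (∀ x, σ (σ x) = x) ∧ (∀ x, σ x ≠ x) ∧
    ¬ ∃ t : Fin (2 * (p + 1)) ↪o α, ∀ a, σ (t a) = t a.rev})

theorem linearIndependent_matchTensor :
    LinearIndependent ℂ fun σ : NestFree α p =>
      (matchTensor σ.1 : (α → Fin p ⊕ Fin p) → ℂ) := by
  rw [Fintype.linearIndependent_iff]
  intro g hg σ
  have hwf : WellFounded fun σ τ : NestFree α p => toLex (⇑τ.1) < toLex (⇑σ.1) :=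
    InvImage.wf (fun σ : NestFree α p => toLex (⇑σ.1)) wellFounded_gt
  induction σ using hwf.induction with
  | _ σ ih =>
  obtain ⟨w, hw, hw'⟩ := exists_word σ.2.1 σ.2.2.1 σ.2.2.2
  have h := congrFun hg w
  rw [Finset.sum_apply, Finset.sum_eq_single σ] at h
  · exact (mul_eq_zero.1 h).resolve_right hw
  · intro τ _ hτ
    by_cases h0 : matchTensor τ.1 w = 0
    · simp [h0]
    · simp [ih τ (hw' τ.1 τ.2.1 τ.2.2.1 h0 fun he => hτ (Subtype.ext he))]
  · simp

theorem finrank_invariants :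
    Module.finrank ℂ (invariants α p) = Fintype.card (NestFree α p) := by
  apply le_antisymm
  · let L : invariants α p →ₗ[ℂ] (NestFree α p → ℂ) :=
      { toFun := fun v σ => ∑ w, matchTensor σ.1 w * v.1 w
        map_add' := fun u v => by
          funext σ
          simp [mul_add, Finset.sum_add_distrib]
        map_smul' := fun z v => by
          funext σ
          simp [Finset.mul_sum, mul_left_comm] }
    have hL : Injective L := by
      rw [injective_iff_map_eq_zero]
      intro v hv
      refine Subtype.ext (eq_zero_of_sum_matchTensor_mul_eq_zero univ v.1 ?_ ?_ ?_)
      · simp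
      · exact fun X hX => lieAct_eq_zero_of_invariant (mem_invariants.1 v.2) X hX
      · intro σ hσ hfix
        refine sum_matchTensor_mul_eq_zero_of_nest (n := 2 * (p + 1)) (by omega) ?_ σ hσ
          (by simpa using hfix)
        exact fun τ hτ hτfix hnest => congrFun hv ⟨τ, hτ, hτfix, hnest⟩
    simpa using LinearMap.finrank_le_finrank_of_injective hL
  · have hmem : ∀ σ : NestFree α p, matchTensor σ.1 ∈ invariants α p := fun σ =>
      mem_invariants.2 (tensorPower_mulVec_matchTensor σ.2.1 σ.2.2.1)
    refine LinearIndependent.fintype_card_le_finrank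
      (b := fun σ : NestFree α p => (⟨matchTensor σ.1, hmem σ⟩ : invariants α p)) ?_
    exact LinearIndependent.of_comp (invariants α p).subtype linearIndependent_matchTensor

end Independence

end RainsTrace

/-- Rains' trace formula: the number of fixed point free involutions of `{1,…,2N}`
with longest decreasing subsequence at most `2p` equals the Haar expectation of
`(Tr S)^{2N}` over `USp(2p)`. -/
theorem rains_trace_formula (N p : ℕ)
    [MeasurableSpace (USp p)] [BorelSpace (USp p)]
    (μ : Measure (USp p)) [μ.IsHaarMeasure] [IsProbabilityMeasure μ] :
    (Nat.card {σ : Equiv.Perm (Fin (2 * N)) //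
        σ ^ 2 = 1 ∧ (∀ a, σ a ≠ a) ∧ ∀ q, HasDecSub σ q → q ≤ 2 * p} : ℂ) =
      ∫ S : USp p,
        (Matrix.trace ((S : Matrix.unitaryGroup (Fin p ⊕ Fin p) ℂ) :
          Matrix (Fin p ⊕ Fin p) (Fin p ⊕ Fin p) ℂ)) ^ (2 * N) ∂μ := by
  have hcard : Nat.card {σ : Equiv.Perm (Fin (2 * N)) //
        σ ^ 2 = 1 ∧ (∀ a, σ a ≠ a) ∧ ∀ q, HasDecSub σ q → q ≤ 2 * p} =
      Fintype.card (RainsTrace.NestFree (Fin (2 * N)) p) := by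
    rw [← Nat.card_eq_fintype_card]
    refine Nat.card_congr (Equiv.subtypeEquivRight fun σ => ?_)
    have hinv : σ ^ 2 = 1 ↔ ∀ x, σ (σ x) = x := by
      rw [sq, Equiv.ext_iff]
      rfl
    rw [hinv]
    refine and_congr_right fun hσ => and_congr_right fun hfix => ⟨?_, ?_⟩
    · rintro h ⟨t, ht⟩
      have := h (2 * (p + 1)) ⟨t, t.strictMono, fun a b hab => by
        simpa only [ht, t.lt_iff_lt, Fin.rev_lt_rev] using hab⟩
      omega
    · rintro h q ⟨t, ht, ht'⟩
      by_contra hq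
      exact h (RainsTrace.exists_nest_of_decreasing hσ hfix (not_le.1 hq) ht ht')
  have hint := RainsTrace.integral_trace_pow_eq_finrank (α := Fin (2 * N)) μ
  rw [Fintype.card_fin] at hint
  rw [hint, RainsTrace.finrank_invariants, hcard]
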